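/- Let W be a Coxeter group with generators S = {s₁, …, s_n} and Coxeter graph Γ (edges {i,j} when m_{i,j} ≥ 3). For any Coxeter element c (a product of all generators in some order), the orientation ω(c) of Γ that orients s_i → s_j whenever s_i precedes s_j in some reduced word for c is well-defined and acyclic, and conjugating c by its initial generator s_{x₁} (so that s_{x₁} c s_{x₁} = s_{x₂} ⋯ s_{x_n} s_{x₁}) transforms ω(c) by converting the source s_{x₁} into a sink. -/

import Mathlib

/-- A directed cycle (closed directed walk with at least one edge). -/
def HasCycle {α : Type*} (r : α → α → Prop) : Prop :=
  ∃ (n : ℕ) (f : Fin (n + 1) → α),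
    (∀ i : Fin n, r (f i.castSucc) (f i.succ)) ∧ r (f (Fin.last n)) (f 0)

/-- The orientation obtained from `r` by reversing all edges incident to `v`. -/
def flipAt {V : Type*} (r : V → V → Prop) (v : V) : V → V → Prop :=
  fun i j => ((i = v ∨ j = v) ∧ r j i) ∨ (¬(i = v ∨ j = v) ∧ r i j)

/-- The edge relation of the Coxeter graph Γ of `M`: an edge `{i,j}` whenever
`m_{i,j} ≥ 3` (where `0` encodes `m_{i,j} = ∞`). -/
def coxEdge {n : ℕ} (M : CoxeterMatrix (Fin n)) (i j : Fin n) : Prop :=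
  3 ≤ M i j ∨ M i j = 0

/-- The orientation ω(c) of the Coxeter graph induced by the ordering `σ` of the
generators: `s_i → s_j` iff `s_i` precedes `s_j` in the word `s_{σ 0} ⋯ s_{σ (n-1)}`. -/
def coxOrient {n : ℕ} (M : CoxeterMatrix (Fin n)) (σ : Equiv.Perm (Fin n))
    (i j : Fin n) : Prop :=
  coxEdge M i j ∧ σ.symm i < σ.symm j

/-- The Coxeter element given by multiplying the generators in the order `σ`. -/
def coxeterElement {n : ℕ} (M : CoxeterMatrix (Fin n)) (σ : Equiv.Perm (Fin n)) :
    M.Group :=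
  (List.ofFn fun i : Fin n => M.simple (σ i)).prod

open Module in
/-- The Cartan-type matrix. -/
noncomputable def coxA {n : ℕ} (M : CoxeterMatrix (Fin n)) (i j : Fin n) : ℝ :=
  -2 * Real.cos (Real.pi / (M i j : ℝ))

/-- Simple coroot. -/
noncomputable def coxF {n : ℕ} (M : CoxeterMatrix (Fin n)) (i : Fin n) :
    Module.Dual ℝ ((Fin n → ℝ) × (Fin n → ℝ)) where
  toFun v := ∑ j, coxA M i j * v.1 j + v.2 i
  map_add' u v := by
    simp only [Prod.fst_add, Prod.snd_add, Pi.add_apply, mul_add, Finset.sum_add_distrib]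
    ring
  map_smul' c v := by
    simp only [Prod.smul_fst, Prod.smul_snd, Pi.smul_apply, smul_eq_mul, RingHom.id_apply, mul_add,
      Finset.mul_sum]
    congr 1
    exact Finset.sum_congr rfl fun j _ => by ring

/-- Simple root. -/
def coxE {n : ℕ} (i : Fin n) : (Fin n → ℝ) × (Fin n → ℝ) := (Pi.single i 1, 0)

theorem coxF_apply {n : ℕ} (M : CoxeterMatrix (Fin n)) (i : Fin n) (v) :
    coxF M i v = ∑ j, coxA M i j * v.1 j + v.2 i := rfl

theorem coxF_coxE {n : ℕ} (M : CoxeterMatrix (Fin n)) (i j : Fin n) :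
    coxF M i (coxE j) = coxA M i j := by
  simp [coxF_apply, coxE, Pi.single_apply]

theorem coxF_self {n : ℕ} (M : CoxeterMatrix (Fin n)) (i : Fin n) :
    coxF M i (coxE i) = 2 := by
  rw [coxF_coxE]; simp [coxA]

theorem cox_sin_ne {m : ℕ} (hm : 3 ≤ m) : Real.sin (2 * (Real.pi / m)) ≠ 0 := by
  have h3 : (3 : ℝ) ≤ m := by exact_mod_cast hm
  have hp := Real.pi_pos
  apply ne_of_gt
  apply Real.sin_pos_of_pos_of_lt_pi
  · positivity
  · rw [← mul_div_assoc, div_lt_iff₀ (by linarith)]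
    nlinarith

open Polynomial Polynomial.Chebyshev in
theorem cox_cheb {m : ℕ} (hm : 3 ≤ m) (t : ℝ) (ht : t = 2 * Real.cos (2 * (Real.pi / m))) :
    (S ℝ (((m : ℤ) - 2) / 2)).eval t *
      ((S ℝ (((m : ℤ) - 1) / 2)).eval t + (S ℝ (((m : ℤ) - 3) / 2)).eval t) = 0 ∧
    (S ℝ (((m : ℤ) - 1) / 2)).eval t *
      ((S ℝ ((m : ℤ) / 2)).eval t + (S ℝ (((m : ℤ) - 2) / 2)).eval t) = 0 := by
  have hs := cox_sin_ne hm
  have hm0 : (m : ℝ) ≠ 0 := by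
    have : m ≠ 0 := by omega
    exact_mod_cast this
  have key : ∀ k : ℤ, (S ℝ k).eval t * Real.sin (2 * (Real.pi / m)) =
      Real.sin ((k + 1) * (2 * (Real.pi / m))) := fun k => by
    rw [ht]; exact S_two_mul_real_cos _ k
  rcases Nat.even_or_odd' m with ⟨k, hk | hk⟩
  · have e1 : ((m : ℤ) - 2) / 2 = k - 1 := by omega
    have e2 : ((m : ℤ) - 1) / 2 = k - 1 := by omega
    have h0 : (S ℝ ((k : ℤ) - 1)).eval t = 0 := by
      have h := key ((k : ℤ) - 1)
      have e : (((k : ℤ) - 1 : ℤ) + 1 : ℝ) * (2 * (Real.pi / m)) = Real.pi := by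
        have : (m : ℝ) = 2 * k := by exact_mod_cast hk
        push_cast
        field_simp
        rw [this]; ring
      rw [e, Real.sin_pi] at h
      exact (mul_eq_zero.mp h).resolve_right hs
    rw [e1, e2, h0]; simp
  · have e1 : ((m : ℤ) - 2) / 2 = k - 1 := by omega
    have e2 : ((m : ℤ) - 1) / 2 = k := by omega
    have e3 : ((m : ℤ) - 3) / 2 = k - 1 := by omega
    have e4 : (m : ℤ) / 2 = k := by omega
    have h0 : (S ℝ (k : ℤ)).eval t + (S ℝ ((k : ℤ) - 1)).eval t = 0 := by
      have h1 := key k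
      have h2 := key ((k : ℤ) - 1)
      have e : ((k : ℤ) + 1 : ℝ) * (2 * (Real.pi / m)) =
          2 * Real.pi - (((k : ℤ) - 1 : ℤ) + 1 : ℝ) * (2 * (Real.pi / m)) := by
        have : (m : ℝ) = 2 * k + 1 := by exact_mod_cast hk
        push_cast
        field_simp
        rw [this]; ring
      rw [e, Real.sin_two_pi_sub, ← h2] at h1
      have : ((S ℝ (k : ℤ)).eval t + (S ℝ ((k : ℤ) - 1)).eval t) *
        Real.sin (2 * (Real.pi / m)) = 0 := by rw [add_mul, h1]; ring
      exact (mul_eq_zero.mp this).resolve_right hs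
    rw [e1, e2, e3, e4, h0]; simp

/-- The reflection. -/
noncomputable def coxR {n : ℕ} (M : CoxeterMatrix (Fin n)) (i : Fin n) :
    ((Fin n → ℝ) × (Fin n → ℝ)) ≃ₗ[ℝ] ((Fin n → ℝ) × (Fin n → ℝ)) :=
  Module.reflection (coxF_self M i)

theorem coxR_apply {n : ℕ} (M : CoxeterMatrix (Fin n)) (i : Fin n) (v) :
    coxR M i v = v - coxF M i v • coxE i := Module.reflection_apply _ _

theorem coxR_liftable {n : ℕ} (M : CoxeterMatrix (Fin n)) : M.IsLiftable (coxR M) := by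
  intro i j
  by_cases hij : i = j
  · subst hij
    rw [M.diagonal, pow_one]
    ext1 v
    exact Module.involutive_reflection (coxF_self M i) v
  have h1 : M i j ≠ 1 := M.off_diagonal i j hij
  have hsym : coxA M j i = coxA M i j := by simp [coxA, M.symmetric i j]
  by_cases h0 : M i j = 0
  · rw [h0, pow_zero]
  by_cases h2 : M i j = 2
  · have hA : coxA M i j = 0 := by simp [coxA, h2]
    have hA' : coxA M j i = 0 := hsym.trans hA
    rw [h2]
    ext1 v
    simp only [pow_two, LinearEquiv.mul_apply, coxR_apply, map_sub, map_smul, coxF_coxE,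
      hA, hA', LinearEquiv.coe_one, id, show ∀ i, coxA M i i = 2 by simp [coxA]]
    module
  · have h3 : 3 ≤ M i j := by omega
    ext1 v
    have ht : coxF M i (coxE j) * coxF M j (coxE i) - 2 =
        2 * Real.cos (2 * (Real.pi / (M i j : ℕ))) := by
      rw [coxF_coxE, coxF_coxE, hsym, Real.cos_two_mul, coxA]; ring
    obtain ⟨c1, c2⟩ := cox_cheb h3 _ ht
    have := Module.reflection_mul_reflection_pow_apply (coxF_self M i) (coxF_self M j) (M i j) v
    rw [c1, c2] at this
    simpa [coxR] using this

/-- The representation. -/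
noncomputable def coxRep {n : ℕ} (M : CoxeterMatrix (Fin n)) :
    M.Group →* (((Fin n → ℝ) × (Fin n → ℝ)) ≃ₗ[ℝ] ((Fin n → ℝ) × (Fin n → ℝ))) :=
  M.toCoxeterSystem.lift ⟨coxR M, coxR_liftable M⟩

theorem coxRep_simple {n : ℕ} (M : CoxeterMatrix (Fin n)) (i : Fin n) :
    coxRep M (M.simple i) = coxR M i :=
  M.toCoxeterSystem.lift_apply_simple (coxR_liftable M) i

theorem cox_list {n : ℕ} (M : CoxeterMatrix (Fin n)) (y : Fin n → ℝ) (l : List (Fin n))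
    (hl : l.Nodup) :
    ((l.map (coxR M)).prod (0, y)).2 = y ∧
    (∀ k, k ∉ l → ((l.map (coxR M)).prod (0, y)).1 k = 0) ∧
    (∀ k ∈ l, ((l.map (coxR M)).prod (0, y)).1 k = - y k -
      ∑ j, if l.idxOf k < l.idxOf j then
        coxA M k j * ((l.map (coxR M)).prod (0, y)).1 j else 0) := by
  induction l with
  | nil => simp
  | cons a l ih =>
    rw [List.nodup_cons] at hl
    obtain ⟨ha, hl⟩ := hl
    obtain ⟨i1, i2, i3⟩ := ih hl
    rw [List.map_cons, List.prod_cons, LinearEquiv.mul_apply]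
    set w := (l.map (coxR M)).prod (0, y) with hw
    have hwa : w.1 a = 0 := i2 a ha
    have hne : ∀ k, k ≠ a → (coxR M a w).1 k = w.1 k := by
      intro k hk
      simp [coxR_apply, coxE, hk]
    have hself : (coxR M a w).1 a = -y a - ∑ j, coxA M a j * w.1 j := by
      simp only [coxR_apply, coxE, coxF_apply, Prod.fst_sub, Prod.smul_fst, Pi.sub_apply,
        Pi.smul_apply, Pi.single_eq_same, hwa, i1, smul_eq_mul]
      ring
    refine ⟨?_, ?_, ?_⟩
    · simp [coxR_apply, coxE, i1]
    · intro k hk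
      rw [List.mem_cons, not_or] at hk
      rw [hne k hk.1, i2 k hk.2]
    · intro k hk
      by_cases hka : k = a
      · subst hka
        rw [hself]
        congr 1
        refine Finset.sum_congr rfl fun j _ => ?_
        by_cases hj : j = k
        · subst hj; simp [hwa]
        · rw [List.idxOf_cons_self, List.idxOf_cons_ne _ (Ne.symm hj), hne j hj,
            if_pos (Nat.succ_pos _)]
      · have hkl : k ∈ l := (List.mem_cons.mp hk).resolve_left hka
        rw [hne k hka, i3 k hkl]
        congr 1
        refine Finset.sum_congr rfl fun j _ => ?_
        by_cases hj : j = a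
        · subst hj; simp [hwa]
        · rw [List.idxOf_cons_ne _ (Ne.symm hj), List.idxOf_cons_ne _ (Ne.symm hka), hne j hj]
          simp

theorem cox_idxOf {n : ℕ} (σ : Equiv.Perm (Fin n)) (k : Fin n) :
    (List.ofFn σ).idxOf k = (σ.symm k : ℕ) := by
  have hnd : (List.ofFn σ).Nodup := List.nodup_ofFn.mpr σ.injective
  have hlt : (σ.symm k : ℕ) < (List.ofFn σ).length := by simp
  have := hnd.idxOf_getElem (σ.symm k : ℕ) hlt
  simpa using this

theorem coxRep_element {n : ℕ} (M : CoxeterMatrix (Fin n)) (σ : Equiv.Perm (Fin n)) :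
    coxRep M (coxeterElement M σ) = ((List.ofFn σ).map (coxR M)).prod := by
  rw [coxeterElement, map_list_prod, List.map_ofFn, List.map_ofFn]
  exact congrArg (fun f => (List.ofFn f).prod) (funext fun i => coxRep_simple M (σ i))

theorem cox_formula {n : ℕ} (M : CoxeterMatrix (Fin n)) (σ : Equiv.Perm (Fin n))
    (y : Fin n → ℝ) (k : Fin n) :
    (coxRep M (coxeterElement M σ) (0, y)).1 k = - y k -
      ∑ j, if σ.symm k < σ.symm j then
        coxA M k j * (coxRep M (coxeterElement M σ) (0, y)).1 j else 0 := by
  have h := (cox_list M y (List.ofFn σ) (List.nodup_ofFn.mpr σ.injective)).2.2 k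
    (by simp [List.mem_ofFn, σ.surjective k])
  rw [← coxRep_element] at h
  simp only [cox_idxOf, Fin.val_fin_lt] at h
  exact h

/-- `c` restricted to `(0,y)` takes every first-component value. -/
theorem cox_surj {n : ℕ} (M : CoxeterMatrix (Fin n)) (σ : Equiv.Perm (Fin n))
    (z : Fin n → ℝ) : ∃ y, (coxRep M (coxeterElement M σ) (0, y)).1 = z := by
  let L : (Fin n → ℝ) →ₗ[ℝ] (Fin n → ℝ) :=
    (LinearMap.fst ℝ _ _) ∘ₗ (coxRep M (coxeterElement M σ)).toLinearMap ∘ₗ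
      (LinearMap.inr ℝ (Fin n → ℝ) (Fin n → ℝ))
  have hL : ∀ y, L y = (coxRep M (coxeterElement M σ) (0, y)).1 := fun y => rfl
  have hinj : Function.Injective L := by
    rw [injective_iff_map_eq_zero]
    intro y hy
    funext k
    have h := cox_formula M σ y k
    rw [← hL, hy] at h
    simpa using h
  exact (LinearMap.injective_iff_surjective.mp hinj) z

theorem coxA_ne {n : ℕ} (M : CoxeterMatrix (Fin n)) {i j : Fin n} (h : coxEdge M i j) :
    coxA M i j ≠ 0 := by
  rcases h with h | h
  · have h3 : (3 : ℝ) ≤ (M i j : ℕ) := by exact_mod_cast h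
    have hp := Real.pi_pos
    have : 0 < Real.cos (Real.pi / (M i j : ℕ)) := by
      apply Real.cos_pos_of_mem_Ioo
      constructor
      · have : 0 ≤ Real.pi / (M i j : ℕ) := by positivity
        linarith
      · rw [div_lt_div_iff₀ (by linarith) (by norm_num)]
        nlinarith
    simp only [coxA]
    intro h'
    linarith
  · simp [coxA, h]

theorem cox_wd {n : ℕ} (M : CoxeterMatrix (Fin n)) (σ τ : Equiv.Perm (Fin n))
    (h : coxeterElement M τ = coxeterElement M σ) (i j : Fin n) :
    coxOrient M τ i j ↔ coxOrient M σ i j := by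
  unfold coxOrient
  refine and_congr_right fun he => ?_
  obtain ⟨y, hy⟩ := cox_surj M σ (Pi.single j 1)
  have h1 := cox_formula M σ y i
  have h2 := cox_formula M τ y i
  rw [h] at h2
  rw [hy] at h1 h2
  have hA := coxA_ne M he
  have hs : ∀ ρ : Equiv.Perm (Fin n), (∑ k, if ρ.symm i < ρ.symm k then
      coxA M i k * (Pi.single j 1 : Fin n → ℝ) k else 0) =
      if ρ.symm i < ρ.symm j then coxA M i j else 0 := by
    intro ρ
    rw [Finset.sum_eq_single j]
    · simp
    · intro k _ hk; simp [hk]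
    · simp
  rw [hs] at h1 h2
  split_ifs at h1 h2 with a b b
  · simp [a, b]
  · exfalso; apply hA; linarith
  · exfalso; apply hA; linarith
  · simp [a, b]

theorem cox_acyclic {n : ℕ} (M : CoxeterMatrix (Fin n)) (σ : Equiv.Perm (Fin n)) :
    ¬ HasCycle (coxOrient M σ) := by
  rintro ⟨m, f, h, h'⟩
  have hm : StrictMono fun i => σ.symm (f i) :=
    Fin.strictMono_iff_lt_succ.mpr fun i => (h i).2
  exact absurd (hm.monotone (Fin.zero_le (Fin.last m))) (not_le.mpr h'.2)

theorem cox_flip {m : ℕ} (M : CoxeterMatrix (Fin (m + 1))) (σ : Equiv.Perm (Fin (m + 1))) :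
    coxeterElement M ((finRotate (m + 1)).trans σ) =
      M.simple (σ 0) * coxeterElement M σ * M.simple (σ 0) ∧
    ∀ i j, coxOrient M ((finRotate (m + 1)).trans σ) i j ↔
      flipAt (coxOrient M σ) (σ 0) i j := by
  constructor
  · have hs : M.simple (σ 0) * M.simple (σ 0) = 1 :=
      M.toCoxeterSystem.simple_mul_simple_self (σ 0)
    unfold coxeterElement
    rw [List.ofFn_succ', List.concat_eq_append, List.prod_append, List.prod_cons,
      List.prod_nil, mul_one, List.ofFn_succ (f := fun i => M.simple (σ i)), List.prod_cons,
      ← mul_assoc (M.simple (σ 0)), hs, one_mul]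
    simp [finRotate_succ_apply]
  · intro i j
    have hsymm : coxEdge M j i ↔ coxEdge M i j := by
      unfold coxEdge; rw [M.symmetric i j]
    have hv : ∀ p : Fin (m + 1), (((finRotate (m + 1)).symm p : Fin (m + 1)) : ℕ) =
        if p = 0 then m else (p : ℕ) - 1 := by
      intro p
      obtain ⟨q, rfl⟩ := (finRotate (m + 1)).surjective p
      rw [Equiv.symm_apply_apply]
      by_cases hq : q = Fin.last m
      · subst hq; simp
      · have hq' : (q : ℕ) < m := by
          have := Fin.val_lt_last hq; exact this
        have e : ((finRotate (m + 1) q : Fin (m + 1)) : ℕ) = q + 1 :=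
          coe_finRotate_of_ne_last hq
        rw [if_neg, e]
        · simp
        · intro h0; rw [h0] at e; simp at e
    have hz : ∀ i, i = σ 0 ↔ σ.symm i = 0 := fun i => (Equiv.symm_apply_eq σ).symm
    unfold flipAt coxOrient
    rw [hsymm, hz, hz, Equiv.symm_trans_apply, Equiv.symm_trans_apply]
    generalize σ.symm i = p
    generalize σ.symm j = q
    have key : (finRotate (m + 1)).symm p < (finRotate (m + 1)).symm q ↔
        (((p = 0 ∨ q = 0) ∧ q < p) ∨ (¬ (p = 0 ∨ q = 0) ∧ p < q)) := by
      rw [Fin.lt_def, hv, hv, Fin.lt_def, Fin.lt_def]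
      simp only [Fin.ext_iff, Fin.val_zero]
      have := p.2
      have := q.2
      split_ifs <;> omega
    rw [key]
    tauto

/-- For a Coxeter element c, the orientation ω(c) of the Coxeter graph
(orienting s_i → s_j when s_i precedes s_j in some reduced word for c) is well-defined
(depends only on c, not on the chosen ordering) and acyclic; and conjugating c by its
initial generator transforms ω(c) by converting that source into a sink. -/
theorem stmt_19 (n : ℕ) (hn : 0 < n) (M : CoxeterMatrix (Fin n))
    (σ : Equiv.Perm (Fin n)) :
    (∀ τ : Equiv.Perm (Fin n), coxeterElement M τ = coxeterElement M σ →
        ∀ i j : Fin n, coxOrient M τ i j ↔ coxOrient M σ i j) ∧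
    ¬ HasCycle (coxOrient M σ) ∧
    (∀ τ : Equiv.Perm (Fin n),
        coxeterElement M τ =
          M.simple (σ ⟨0, hn⟩) * coxeterElement M σ * M.simple (σ ⟨0, hn⟩) →
        ∀ i j : Fin n, coxOrient M τ i j ↔ flipAt (coxOrient M σ) (σ ⟨0, hn⟩) i j) := by
  refine ⟨fun τ h => cox_wd M σ τ h, cox_acyclic M σ, ?_⟩
  intro τ h i j
  obtain ⟨m, rfl⟩ : ∃ m, n = m + 1 := ⟨n - 1, by omega⟩
  obtain ⟨h1, h2⟩ := cox_flip M σ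
  exact (cox_wd M _ τ (h.trans h1.symm) i j).trans (h2 i j)
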